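/- Let f(x, u, p, q) be smooth and affine in q, f = A(x,u,p) + q·B(x,u,p), and suppose the scalar Helmholtz condition ∂f/∂p = D_x(∂f/∂q) holds identically, where D_x = ∂_x + p∂_u + q∂_p. Then L(x,u,p) := ∫₀¹ f(x, tu, tp, 0)·u dt + correction terms can be chosen so that f = ∂L/∂u − D_x(∂L/∂p); in particular f is locally variational. -/

import Mathlib

/-- `∂f/∂q` for a second-order function `f(x,u,p,q)`. -/
noncomputable def fq (f : ℝ → ℝ → ℝ → ℝ → ℝ) (x u p q : ℝ) : ℝ :=
  deriv (fun t => f x u p t) q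

/-- `∂L/∂p` for a first-order Lagrangian `L(x,u,p)`. -/
noncomputable def Lp (L : ℝ → ℝ → ℝ → ℝ) (x u p : ℝ) : ℝ := deriv (fun t => L x u t) p

/-- The Euler–Lagrange expression `∂L/∂u - D_x(∂L/∂p)` with `D_x = ∂_x + p ∂_u + q ∂_p`. -/
noncomputable def ELexpr (L : ℝ → ℝ → ℝ → ℝ) (x u p q : ℝ) : ℝ :=
  deriv (fun t => L x t p) u
    - (deriv (fun t => Lp L t u p) x + p * deriv (fun t => Lp L x t p) u
        + q * deriv (fun t => Lp L x u t) p)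

open MeasureTheory intervalIntegral in
theorem param_hasFDerivAt {E F : Type} [NormedAddCommGroup E] [NormedSpace ℝ E]
    [FiniteDimensional ℝ E] [NormedAddCommGroup F] [NormedSpace ℝ F]
    (G : E × ℝ → F) (hG : ContDiff ℝ 1 G) (e : E) :
    HasFDerivAt (fun e => ∫ t in (0:ℝ)..1, G (e, t))
      (∫ t in (0:ℝ)..1, (fderiv ℝ G (e, t)).comp (ContinuousLinearMap.inl ℝ E ℝ)) e := by
  have hc : Continuous (fun z : E × ℝ =>
      (fderiv ℝ G z).comp (ContinuousLinearMap.inl ℝ E ℝ)) :=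
    (hG.continuous_fderiv (by norm_num)).clm_comp continuous_const
  have hK : IsCompact (Metric.closedBall e 1 ×ˢ Set.Icc (0:ℝ) 1) :=
    (isCompact_closedBall e 1).prod isCompact_Icc
  obtain ⟨C, hC⟩ := hK.exists_bound_of_continuousOn hc.continuousOn
  refine intervalIntegral.hasFDerivAt_integral_of_dominated_of_fderiv_le
    (F := fun e t => G (e, t)) (bound := fun _ => C)
    (F' := fun e t => (fderiv ℝ G (e, t)).comp (ContinuousLinearMap.inl ℝ E ℝ))
    (Metric.closedBall_mem_nhds e one_pos) ?_ ?_ ?_ ?_ ?_ ?_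
  · refine Filter.Eventually.of_forall fun x => ?_
    exact (hG.continuous.comp (by fun_prop : Continuous fun t : ℝ => (x, t))).aestronglyMeasurable
  · exact (hG.continuous.comp (by fun_prop : Continuous fun t : ℝ => (e, t))).intervalIntegrable _ _
  · exact (hc.comp (by fun_prop : Continuous fun t : ℝ => (e, t))).aestronglyMeasurable
  · refine Filter.Eventually.of_forall fun t ht x hx => hC (x, t) ⟨hx, ?_⟩
    rw [Set.uIoc_of_le zero_le_one] at ht
    exact ⟨ht.1.le, ht.2⟩
  · exact intervalIntegrable_const
  · refine Filter.Eventually.of_forall fun t ht x hx => ?_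
    exact ((hG.differentiable (by norm_num)) (x, t)).hasFDerivAt.comp x (hasFDerivAt_prodMk_left x t)

theorem param_contDiff_nat {E : Type} [NormedAddCommGroup E] [NormedSpace ℝ E]
    [FiniteDimensional ℝ E] (n : ℕ) : ∀ {F : Type} [NormedAddCommGroup F] [NormedSpace ℝ F]
    (G : E × ℝ → F) (_ : ContDiff ℝ n G),
    ContDiff ℝ n (fun e => ∫ t in (0:ℝ)..1, G (e, t)) := by
  induction n with
  | zero =>
    intro F _ _ G hG
    rw [Nat.cast_zero, contDiff_zero] at hG ⊢
    exact intervalIntegral.continuous_parametric_intervalIntegral_of_continuous'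
      (f := fun e t => G (e, t)) hG 0 1
  | succ n ih =>
    intro F _ _ G hG
    have h1 : ContDiff ℝ 1 G := hG.of_le (by exact_mod_cast Nat.le_add_left 1 n)
    have hd := param_hasFDerivAt G h1
    push_cast at hG ⊢
    rw [contDiff_succ_iff_fderiv]
    refine ⟨fun e => (hd e).differentiableAt, by simp, ?_⟩
    have : fderiv ℝ (fun e => ∫ t in (0:ℝ)..1, G (e, t)) = fun e => ∫ t in (0:ℝ)..1,
        (fderiv ℝ G (e, t)).comp (ContinuousLinearMap.inl ℝ E ℝ) := funext fun e => (hd e).fderiv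
    rw [this]
    exact ih (fun z => (fderiv ℝ G z).comp (ContinuousLinearMap.inl ℝ E ℝ))
      ((hG.fderiv_right le_rfl).clm_comp contDiff_const)

theorem param_contDiff {E : Type} [NormedAddCommGroup E] [NormedSpace ℝ E]
    [FiniteDimensional ℝ E] (G : E × ℝ → ℝ) (hG : ContDiff ℝ (⊤ : ℕ∞) G) :
    ContDiff ℝ (⊤ : ℕ∞) (fun e => ∫ t in (0:ℝ)..1, G (e, t)) := by
  rw [contDiff_infty] at hG ⊢
  exact fun n => param_contDiff_nat n G (hG n)

/-- Primitive in the last variable. -/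
theorem prim_contDiff (b : ℝ × ℝ × ℝ → ℝ) (hb : ContDiff ℝ (⊤ : ℕ∞) b) :
    ContDiff ℝ (⊤ : ℕ∞) (fun v : ℝ × ℝ × ℝ => ∫ s in (0:ℝ)..v.2.2, b (v.1, v.2.1, s)) := by
  have : (fun v : ℝ × ℝ × ℝ => ∫ s in (0:ℝ)..v.2.2, b (v.1, v.2.1, s)) =
      fun v => v.2.2 * ∫ t in (0:ℝ)..1, b (v.1, v.2.1, v.2.2 * t) := by
    funext v
    have := intervalIntegral.smul_integral_comp_mul_left (a := 0) (b := 1)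
      (fun s => b (v.1, v.2.1, s)) v.2.2
    simpa using this.symm
  rw [this]
  refine ContDiff.mul (by fun_prop) ?_
  exact param_contDiff (fun z : (ℝ × ℝ × ℝ) × ℝ => b (z.1.1, z.1.2.1, z.1.2.2 * z.2))
    (hb.comp (by fun_prop))

theorem prim_hasDerivAt (b : ℝ × ℝ × ℝ → ℝ) (hb : Continuous b) (x u p : ℝ) :
    HasDerivAt (fun p => ∫ s in (0:ℝ)..p, b (x, u, s)) (b (x, u, p)) p := by
  have hc : Continuous fun s => b (x, u, s) := by fun_prop
  exact hc.integral_hasStrictDerivAt 0 p |>.hasDerivAt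

theorem hd1 (H : ℝ × ℝ × ℝ → ℝ) (hH : ContDiff ℝ (⊤ : ℕ∞) H) (x u p : ℝ) :
    HasDerivAt (fun t => H (t, u, p)) (fderiv ℝ H (x, u, p) (1, 0, 0)) x :=
  ((hH.differentiable (by simp)) (x, u, p)).hasFDerivAt.comp_hasDerivAt x
    ((hasDerivAt_id x).prodMk (hasDerivAt_const x (u, p)))

theorem hd2 (H : ℝ × ℝ × ℝ → ℝ) (hH : ContDiff ℝ (⊤ : ℕ∞) H) (x u p : ℝ) :
    HasDerivAt (fun t => H (x, t, p)) (fderiv ℝ H (x, u, p) (0, 1, 0)) u :=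
  ((hH.differentiable (by simp)) (x, u, p)).hasFDerivAt.comp_hasDerivAt u
    ((hasDerivAt_const u x).prodMk ((hasDerivAt_id u).prodMk (hasDerivAt_const u p)))

theorem hd3 (H : ℝ × ℝ × ℝ → ℝ) (hH : ContDiff ℝ (⊤ : ℕ∞) H) (x u p : ℝ) :
    HasDerivAt (fun t => H (x, u, t)) (fderiv ℝ H (x, u, p) (0, 0, 1)) p :=
  ((hH.differentiable (by simp)) (x, u, p)).hasFDerivAt.comp_hasDerivAt p
    ((hasDerivAt_const p x).prodMk ((hasDerivAt_const p u).prodMk (hasDerivAt_id p)))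

/-- Mixed partials: the `p`-derivative of `∂_w H` is `∂_w h` when `∂_p H = h`. -/
theorem hd_mixed (H h : ℝ × ℝ × ℝ → ℝ) (hH : ContDiff ℝ (⊤ : ℕ∞) H)
    (hp : ∀ x u p, HasDerivAt (fun t => H (x, u, t)) (h (x, u, p)) p)
    (w : ℝ × ℝ × ℝ) (x u p : ℝ) :
    HasDerivAt (fun t => fderiv ℝ H (x, u, t) w) (fderiv ℝ h (x, u, p) w) p := by
  have hf' : ContDiff ℝ (⊤ : ℕ∞) (fderiv ℝ H) := hH.fderiv_right (by simp)
  have hw : ContDiff ℝ (⊤ : ℕ∞) (fun z => fderiv ℝ H z w) := hf'.clm_apply contDiff_const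
  have e : h = fun z => fderiv ℝ H z (0, 0, 1) := by
    funext ⟨x, u, p⟩
    exact (hp x u p).unique (hd3 H hH x u p)
  have hdd : DifferentiableAt ℝ (fderiv ℝ H) (x, u, p) := hf'.differentiable (by simp) _
  have key : ∀ w' : ℝ × ℝ × ℝ, fderiv ℝ (fun z => fderiv ℝ H z w') (x, u, p)
      = (fderiv ℝ (fderiv ℝ H) (x, u, p)).flip w' := by
    intro w'
    ext1 <;> ext1 <;> simp [fderiv_clm_apply hdd (differentiableAt_const w')]
  have hs : IsSymmSndFDerivAt ℝ H (x, u, p) :=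
    hH.contDiffAt.isSymmSndFDerivAt (by simpa using (by exact_mod_cast le_top : ((2 : ℕ∞) : WithTop ℕ∞) ≤ ((⊤ : ℕ∞) : WithTop ℕ∞)))
  have := hd3 _ hw x u p
  rw [key] at this
  rw [e, key]
  simpa [hs.eq w (0, 0, 1)] using this

/-- Scalar case: a smooth `f` that is affine in `q` and satisfies the Helmholtz
condition `∂f/∂p = D_x(∂f/∂q)` identically admits a first-order Lagrangian `L` with
`f = ∂L/∂u - D_x(∂L/∂p)`; in particular `f` is (locally) variational. -/
theorem stmt_15 (f : ℝ → ℝ → ℝ → ℝ → ℝ) (A B : ℝ → ℝ → ℝ → ℝ)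
    (hf : ContDiff ℝ (⊤ : ℕ∞) (fun v : ℝ × ℝ × ℝ × ℝ => f v.1 v.2.1 v.2.2.1 v.2.2.2))
    (haff : ∀ x u p q, f x u p q = A x u p + q * B x u p)
    (hH : ∀ x u p q : ℝ,
      deriv (fun t => f x u t q) p
        = deriv (fun t => fq f t u p q) x + p * deriv (fun t => fq f x t p q) u
          + q * deriv (fun t => fq f x u t q) p) :
    ∃ L : ℝ → ℝ → ℝ → ℝ,
      ContDiff ℝ (⊤ : ℕ∞) (fun v : ℝ × ℝ × ℝ => L v.1 v.2.1 v.2.2) ∧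
      ∀ x u p q : ℝ, f x u p q = ELexpr L x u p q := by
  have hBf : ∀ x u p, B x u p = f x u p 1 - f x u p 0 := fun x u p => by
    rw [haff, haff]; ring
  have hAf : ∀ x u p, A x u p = f x u p 0 := fun x u p => by rw [haff]; ring
  obtain ⟨a, ha⟩ : ∃ a : ℝ × ℝ × ℝ → ℝ, a = fun v => A v.1 v.2.1 v.2.2 := ⟨_, rfl⟩
  obtain ⟨b, hb⟩ : ∃ b : ℝ × ℝ × ℝ → ℝ, b = fun v => B v.1 v.2.1 v.2.2 := ⟨_, rfl⟩
  have hA : ∀ x u p, A x u p = a (x, u, p) := fun x u p => by rw [ha]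
  have hB : ∀ x u p, B x u p = b (x, u, p) := fun x u p => by rw [hb]
  have hac : ContDiff ℝ (⊤ : ℕ∞) a := by
    rw [ha]; simp only [hAf]
    exact hf.comp (f := fun v : ℝ × ℝ × ℝ => (v.1, v.2.1, v.2.2, (0:ℝ))) (by fun_prop)
  have hbc : ContDiff ℝ (⊤ : ℕ∞) b := by
    rw [hb]; simp only [hBf]
    exact (hf.comp (f := fun v : ℝ × ℝ × ℝ => (v.1, v.2.1, v.2.2, (1:ℝ))) (by fun_prop)).sub
      (hf.comp (f := fun v : ℝ × ℝ × ℝ => (v.1, v.2.1, v.2.2, (0:ℝ))) (by fun_prop))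
  have hfq : ∀ x u p q, fq f x u p q = b (x, u, p) := by
    intro x u p q
    simp only [fq, haff, hA, hB]
    have := ((hasDerivAt_id q).mul_const (b (x, u, p))).const_add (a (x, u, p))
    simpa using this.deriv
  -- Helmholtz: A_p = B_x + p B_u
  have hAp : ∀ x u p, fderiv ℝ a (x, u, p) (0, 0, 1)
      = fderiv ℝ b (x, u, p) (1, 0, 0) + p * fderiv ℝ b (x, u, p) (0, 1, 0) := by
    intro x u p
    have h := hH x u p 0
    simp only [hfq, haff, hA, hB, zero_mul, add_zero] at h
    rw [(hd1 b hbc x u p).deriv, (hd2 b hbc x u p).deriv, (hd3 a hac x u p).deriv] at h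
    exact h
  obtain ⟨I, hI⟩ : ∃ I : ℝ × ℝ × ℝ → ℝ,
    I = fun v => ∫ s in (0:ℝ)..v.2.2, b (v.1, v.2.1, s) := ⟨_, rfl⟩
  have hIc : ContDiff ℝ (⊤ : ℕ∞) I := hI ▸ prim_contDiff b hbc
  have hIp : ∀ x u p, HasDerivAt (fun t => I (x, u, t)) (b (x, u, p)) p := fun x u p => by
    rw [hI]; exact prim_hasDerivAt b hbc.continuous x u p
  have hI0 : ∀ x u, I (x, u, 0) = 0 := fun x u => by simp [hI]
  obtain ⟨J, hJ⟩ : ∃ J : ℝ × ℝ × ℝ → ℝ,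
    J = fun v => ∫ s in (0:ℝ)..v.2.2, I (v.1, v.2.1, s) := ⟨_, rfl⟩
  have hJc : ContDiff ℝ (⊤ : ℕ∞) J := hJ ▸ prim_contDiff I hIc
  have hJp : ∀ x u p, HasDerivAt (fun t => J (x, u, t)) (I (x, u, p)) p := fun x u p => by
    rw [hJ]; exact prim_hasDerivAt I hIc.continuous x u p
  have hJ0 : ∀ x u, J (x, u, 0) = 0 := fun x u => by simp [hJ]
  -- `a0 (x, _, u) = A (x, u, 0)`
  have ha0c : ContDiff ℝ (⊤ : ℕ∞) (fun v : ℝ × ℝ × ℝ => a (v.1, v.2.2, 0)) :=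
    hac.comp (by fun_prop)
  obtain ⟨K, hK⟩ : ∃ K : ℝ → ℝ → ℝ, K = fun x u => ∫ s in (0:ℝ)..u, a (x, s, 0) := ⟨_, rfl⟩
  have hKc : ContDiff ℝ (⊤ : ℕ∞) (fun v : ℝ × ℝ × ℝ => K v.1 v.2.1) := by
    rw [hK]
    exact (prim_contDiff _ ha0c).comp (f := fun v : ℝ × ℝ × ℝ => (v.1, (0:ℝ), v.2.1))
      (by fun_prop)
  have hKu : ∀ x u, HasDerivAt (fun t => K x t) (a (x, u, 0)) u := fun x u => by
    rw [hK]; exact prim_hasDerivAt _ ha0c.continuous x 0 u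
  have key : ∀ x u p, a (x, u, p) - (fderiv ℝ I (x, u, p) (1, 0, 0)
      + p * fderiv ℝ I (x, u, p) (0, 1, 0) - fderiv ℝ J (x, u, p) (0, 1, 0)) = a (x, u, 0) := by
    intro x u p
    have hder : ∀ p, HasDerivAt (fun p => a (x, u, p) - (fderiv ℝ I (x, u, p) (1, 0, 0)
      + p * fderiv ℝ I (x, u, p) (0, 1, 0) - fderiv ℝ J (x, u, p) (0, 1, 0))) 0 p := by
      intro p
      have h := (hd3 a hac x u p).sub (((hd_mixed I b hIc hIp (1, 0, 0) x u p).add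
        ((hasDerivAt_id p).mul (hd_mixed I b hIc hIp (0, 1, 0) x u p))).sub
        (hd_mixed J I hJc hJp (0, 1, 0) x u p))
      refine h.congr_deriv ?_
      rw [hAp]
      simp only [id]
      ring
    have hconst := is_const_of_deriv_eq_zero (fun p => (hder p).differentiableAt)
      (fun p => (hder p).deriv) p 0
    rw [hconst]
    have e1 : fderiv ℝ I (x, u, 0) (1, 0, 0) = 0 :=
      (hd1 I hIc x u 0).unique (by simpa only [hI0] using hasDerivAt_const x (0:ℝ))
    have e3 : fderiv ℝ J (x, u, 0) (0, 1, 0) = 0 :=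
      (hd2 J hJc x u 0).unique (by simpa only [hJ0] using hasDerivAt_const u (0:ℝ))
    rw [e1, e3]; ring
  refine ⟨fun x u p => K x u - J (x, u, p), hKc.sub hJc, ?_⟩
  intro x u p q
  have hLp : ∀ x u p, Lp (fun x u p => K x u - J (x, u, p)) x u p = - I (x, u, p) :=
    fun x u p => ((hJp x u p).const_sub (K x u)).deriv
  unfold ELexpr
  simp only [hLp]
  rw [((hKu x u).fun_sub (hd2 J hJc x u p)).deriv, (hd1 I hIc x u p).fun_neg.deriv,
    (hd2 I hIc x u p).fun_neg.deriv, (hIp x u p).fun_neg.deriv, haff, hA, hB, ← key x u p]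
  ring
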